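/- arXiv:2506.21731 — 6 statements merged into one kernel-verified Lean document; each statement's English description precedes it below -/
import Mathlib

section
/- Let N ≥ 1, let p_1, …, p_N : ℝ^d → ℝ be probability density functions (nonnegative, measurable, each integrating to 1 with respect to Lebesgue measure), let D : ℝ^d → ℝ^m be a measurable map (the decoder), and let x_1, …, x_N ∈ ℝ^m be targets. Then the average reconstruction mean squared error satisfies (1/N) · Σ_{i=1}^N ∫ p_i(z) ‖D(z) − x_i‖² dz ≥ (1/(4N²)) · Σ_{i=1}^N Σ_{j=1}^N OC(p_i, p_j) · ‖x_i − x_j‖². -/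
open MeasureTheory ENNReal

/-- Weighted parallelogram-type bound: the smaller weight times the squared distance of two points
is controlled by the weighted squared distances to any third point. -/
theorem min_mul_sq_norm_sub_le {E : Type*} [SeminormedAddCommGroup E] {a b : ℝ} (ha : 0 ≤ a)
    (hb : 0 ≤ b) (u v w : E) :
    min a b * ‖u - v‖ ^ 2 ≤ 2 * (a * ‖w - u‖ ^ 2 + b * ‖w - v‖ ^ 2) := by
  have h : ‖u - v‖ ≤ ‖w - u‖ + ‖w - v‖ := by
    rw [norm_sub_rev w u]
    exact norm_sub_le_norm_sub_add_norm_sub u w v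
  calc min a b * ‖u - v‖ ^ 2
      ≤ min a b * (2 * (‖w - u‖ ^ 2 + ‖w - v‖ ^ 2)) := by
        gcongr
        exact (pow_le_pow_left₀ (norm_nonneg _) h 2).trans add_sq_le
    _ = 2 * (min a b * ‖w - u‖ ^ 2 + min a b * ‖w - v‖ ^ 2) := by ring
    _ ≤ 2 * (a * ‖w - u‖ ^ 2 + b * ‖w - v‖ ^ 2) := by
        gcongr
        · exact min_le_left a b
        · exact min_le_right a b

/-- The overlap of two densities times the squared distance of the targets is at most twice the sum
of the two reconstruction errors. -/
theorem lintegral_min_mul_sq_norm_sub_le {α E : Type*} [MeasurableSpace α] {μ : Measure α}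
    [NormedAddCommGroup E] [MeasurableSpace E] [OpensMeasurableSpace E] [MeasurableSub E]
    {p q : α → ℝ} (hp_nonneg : ∀ z, 0 ≤ p z) (hq_nonneg : ∀ z, 0 ≤ q z) (hp : Measurable p)
    {D : α → E} (hD : Measurable D) (u v : E) :
    (∫⁻ z, ENNReal.ofReal (min (p z) (q z)) ∂μ) * ENNReal.ofReal (‖u - v‖ ^ 2) ≤
      2 * ((∫⁻ z, ENNReal.ofReal (p z * ‖D z - u‖ ^ 2) ∂μ) +
        ∫⁻ z, ENNReal.ofReal (q z * ‖D z - v‖ ^ 2) ∂μ) := by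
  have hpD : Measurable fun z ↦ ENNReal.ofReal (p z * ‖D z - u‖ ^ 2) :=
    (hp.mul ((hD.sub_const u).norm.pow_const 2)).ennreal_ofReal
  rw [← lintegral_mul_const' _ _ ofReal_ne_top, ← lintegral_add_left hpD,
    ← lintegral_const_mul' _ _ ofNat_ne_top]
  refine lintegral_mono fun z ↦ ?_
  have hpz := hp_nonneg z
  have hqz := hq_nonneg z
  calc ENNReal.ofReal (min (p z) (q z)) * ENNReal.ofReal (‖u - v‖ ^ 2)
      = ENNReal.ofReal (min (p z) (q z) * ‖u - v‖ ^ 2) :=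
        (ENNReal.ofReal_mul (le_min hpz hqz)).symm
    _ ≤ ENNReal.ofReal (2 * (p z * ‖D z - u‖ ^ 2 + q z * ‖D z - v‖ ^ 2)) :=
        ENNReal.ofReal_le_ofReal (min_mul_sq_norm_sub_le hpz hqz u v (D z))
    _ = 2 * (ENNReal.ofReal (p z * ‖D z - u‖ ^ 2) + ENNReal.ofReal (q z * ‖D z - v‖ ^ 2)) := by
        rw [ENNReal.ofReal_mul zero_le_two, ENNReal.ofReal_add (by positivity) (by positivity),
          ENNReal.ofReal_ofNat]

/-- **Reconstruction MSE lower bound.**  For probability densities `p i` on `ℝ^d`, a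
measurable decoder `D : ℝ^d → ℝ^m` and targets `x i ∈ ℝ^m`, the average reconstruction
mean squared error is bounded below by
`(1/(4N²)) · Σᵢⱼ OC(pᵢ, pⱼ) · ‖xᵢ − xⱼ‖²`. -/
theorem reconstruction_mse_lower_bound
    (d m N : ℕ) (hN : 1 ≤ N)
    (p : Fin N → EuclideanSpace ℝ (Fin d) → ℝ)
    (hp_nonneg : ∀ i z, 0 ≤ p i z)
    (hp_meas : ∀ i, Measurable (p i))
    (hp_prob : ∀ i, ∫⁻ z, ENNReal.ofReal (p i z) = 1)
    (D : EuclideanSpace ℝ (Fin d) → EuclideanSpace ℝ (Fin m))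
    (hD : Measurable D)
    (x : Fin N → EuclideanSpace ℝ (Fin m)) :
    (1 / (4 * (N : ℝ≥0∞) ^ 2)) *
        ∑ i : Fin N, ∑ j : Fin N,
          (∫⁻ z, ENNReal.ofReal (min (p i z) (p j z))) *
            ENNReal.ofReal (‖x i - x j‖ ^ 2)
      ≤ (1 / (N : ℝ≥0∞)) *
          ∑ i : Fin N, ∫⁻ z, ENNReal.ofReal (p i z * ‖D z - x i‖ ^ 2) := by
  have hN0 : (N : ℝ≥0∞) ≠ 0 := by exact_mod_cast (by omega : N ≠ 0)
  set S := ∑ i : Fin N, ∫⁻ z, ENNReal.ofReal (p i z * ‖D z - x i‖ ^ 2)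
  calc _ ≤ (1 / (4 * (N : ℝ≥0∞) ^ 2)) * ∑ i : Fin N, ∑ j : Fin N,
          2 * ((∫⁻ z, ENNReal.ofReal (p i z * ‖D z - x i‖ ^ 2)) +
            ∫⁻ z, ENNReal.ofReal (p j z * ‖D z - x j‖ ^ 2)) := by
        refine mul_le_mul' le_rfl (Finset.sum_le_sum fun i _ ↦ Finset.sum_le_sum fun j _ ↦ ?_)
        exact lintegral_min_mul_sq_norm_sub_le (hp_nonneg i) (hp_nonneg j) (hp_meas i) hD _ _
    _ = (1 / (4 * (N : ℝ≥0∞) ^ 2)) * (4 * N * S) := by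
        simp only [← Finset.mul_sum, Finset.sum_add_distrib, Finset.sum_const, Finset.card_univ,
          Fintype.card_fin, nsmul_eq_mul]
        ring
    _ = (1 / (N : ℝ≥0∞)) * S := by
        rw [← mul_assoc]
        congr 1
        rw [mul_comm, mul_one_div, sq, ← mul_assoc]
        nth_rewrite 1 [← mul_one (4 * (N : ℝ≥0∞))]
        exact ENNReal.mul_div_mul_left _ _ (mul_ne_zero four_ne_zero hN0)
          (mul_ne_top ofNat_ne_top (natCast_ne_top N))
end

section
/- Let p, q : ℝ^d → ℝ be probability density functions (nonnegative, measurable, integrating to 1), let D : ℝ^d → ℝ^m be measurable, and let x, y ∈ ℝ^m. Then ∫ p(z) ‖D(z) − x‖² dz + ∫ q(z) ‖D(z) − y‖² dz ≥ (1/2) · OC(p, q) · ‖x − y‖². -/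
open MeasureTheory ENNReal

/-- **Pairwise reconstruction lower bound.**  For probability densities `p, q` on `ℝ^d`,
a measurable decoder `D` and targets `x, y ∈ ℝ^m`,
`∫ p(z)‖D(z)−x‖² dz + ∫ q(z)‖D(z)−y‖² dz ≥ (1/2) · OC(p,q) · ‖x−y‖²`. -/
theorem pairwise_reconstruction_lower_bound
    (d m : ℕ)
    (p q : EuclideanSpace ℝ (Fin d) → ℝ)
    (hp_nonneg : ∀ z, 0 ≤ p z) (hq_nonneg : ∀ z, 0 ≤ q z)
    (hp_meas : Measurable p) (hq_meas : Measurable q)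
    (hp_prob : ∫⁻ z, ENNReal.ofReal (p z) = 1)
    (hq_prob : ∫⁻ z, ENNReal.ofReal (q z) = 1)
    (D : EuclideanSpace ℝ (Fin d) → EuclideanSpace ℝ (Fin m))
    (hD : Measurable D)
    (x y : EuclideanSpace ℝ (Fin m)) :
    ENNReal.ofReal (1 / 2) *
        (∫⁻ z, ENNReal.ofReal (min (p z) (q z))) * ENNReal.ofReal (‖x - y‖ ^ 2)
      ≤ (∫⁻ z, ENNReal.ofReal (p z * ‖D z - x‖ ^ 2)) +
          ∫⁻ z, ENNReal.ofReal (q z * ‖D z - y‖ ^ 2) := by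
  have hpoint : ∀ z, 1 / 2 * min (p z) (q z) * ‖x - y‖ ^ 2
      ≤ p z * ‖D z - x‖ ^ 2 + q z * ‖D z - y‖ ^ 2 := fun z => by
    have htri : ‖x - y‖ ≤ ‖D z - x‖ + ‖D z - y‖ := by
      simpa only [dist_eq_norm, norm_sub_rev x (D z)] using dist_triangle x (D z) y
    have hsq : 1 / 2 * ‖x - y‖ ^ 2 ≤ ‖D z - x‖ ^ 2 + ‖D z - y‖ ^ 2 := by
      nlinarith [norm_nonneg (x - y), sq_nonneg (‖D z - x‖ - ‖D z - y‖)]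
    calc 1 / 2 * min (p z) (q z) * ‖x - y‖ ^ 2
        = min (p z) (q z) * (1 / 2 * ‖x - y‖ ^ 2) := by ring
      _ ≤ min (p z) (q z) * (‖D z - x‖ ^ 2 + ‖D z - y‖ ^ 2) :=
          mul_le_mul_of_nonneg_left hsq (le_min (hp_nonneg z) (hq_nonneg z))
      _ = min (p z) (q z) * ‖D z - x‖ ^ 2 + min (p z) (q z) * ‖D z - y‖ ^ 2 := by ring
      _ ≤ p z * ‖D z - x‖ ^ 2 + q z * ‖D z - y‖ ^ 2 := by
          gcongr
          · exact min_le_left _ _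
          · exact min_le_right _ _
  have hmin : Measurable fun z => ENNReal.ofReal (min (p z) (q z)) :=
    (hp_meas.min hq_meas).ennreal_ofReal
  have hleft : Measurable fun z => ENNReal.ofReal (p z * ‖D z - x‖ ^ 2) :=
    (hp_meas.mul ((hD.sub_const x).norm.pow_const 2)).ennreal_ofReal
  rw [← lintegral_const_mul _ hmin, ← lintegral_mul_const _ (hmin.const_mul _),
    ← lintegral_add_left hleft]
  refine lintegral_mono fun z => ?_
  have hp := hp_nonneg z
  have hq := hq_nonneg z
  have hpq : 0 ≤ min (p z) (q z) := le_min hp hq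
  rw [← ENNReal.ofReal_mul (by norm_num), ← ENNReal.ofReal_mul (by positivity),
    ← ENNReal.ofReal_add (by positivity) (by positivity)]
  exact ENNReal.ofReal_le_ofReal (hpoint z)
end

section
/- Let f : ℝ → ℝ be a nonnegative measurable even function (f(−t) = f(t)) that is nonincreasing on [0, ∞) (a symmetric unimodal density profile). Then the map Δ ↦ ∫ min(f(z), f(z − Δ)) dz is antitone on [0, ∞): for all 0 ≤ Δ₁ ≤ Δ₂, ∫ min(f(z), f(z − Δ₂)) dz ≤ ∫ min(f(z), f(z − Δ₁)) dz. -/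
open MeasureTheory ENNReal

/-- For an even function that is nonincreasing on `[0, ∞)`, the smaller of the values at `w ± h` is
the value at the point farther from the origin, `|w| + h`. -/
lemma min_add_sub_eq_of_even_of_antitoneOn {f : ℝ → ℝ} (hf_even : ∀ t, f (-t) = f t)
    (hf_anti : AntitoneOn f (Set.Ici (0 : ℝ))) {h : ℝ} (hh : 0 ≤ h) (w : ℝ) :
    min (f (w + h)) (f (w - h)) = f (|w| + h) := by
  have f_abs : ∀ t, f |t| = f t := fun t => by
    rcases abs_choice t with ht | ht <;> simp only [ht, hf_even]
  have key : ∀ {a b : ℝ}, |a| ≤ |b| → f b ≤ f a := fun {a b} hab => by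
    simpa only [f_abs] using hf_anti (abs_nonneg a) (abs_nonneg b) hab
  rcases le_total 0 w with hw | hw
  · rw [abs_of_nonneg hw, min_eq_left]
    exact key (by rw [abs_of_nonneg (add_nonneg hw hh), abs_le]; constructor <;> linarith)
  · rw [abs_of_nonpos hw, min_eq_right, ← hf_even]
    · congr 1
      ring
    · exact key (by rw [abs_of_nonpos (by linarith : w - h ≤ 0), abs_le]; constructor <;> linarith)

/-- Centring the two translates at the origin expresses the overlap as the integral of
`f (|w| + Δ / 2)`. -/
lemma lintegral_overlap_eq {f : ℝ → ℝ} (hf_even : ∀ t, f (-t) = f t)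
    (hf_anti : AntitoneOn f (Set.Ici (0 : ℝ))) {Δ : ℝ} (hΔ : 0 ≤ Δ) :
    (∫⁻ z, ENNReal.ofReal (min (f z) (f (z - Δ)))) =
      ∫⁻ w, ENNReal.ofReal (f (|w| + Δ / 2)) := by
  rw [← lintegral_add_right_eq_self _ (Δ / 2)]
  refine lintegral_congr fun w => ?_
  rw [← min_add_sub_eq_of_even_of_antitoneOn hf_even hf_anti (div_nonneg hΔ zero_le_two) w,
    show w + Δ / 2 - Δ = w - Δ / 2 by ring]

/-- **Antitonicity of the overlap in the shift.**  If `f : ℝ → ℝ` is a nonnegative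
measurable even function that is nonincreasing on `[0, ∞)`, then
`Δ ↦ ∫ min(f(z), f(z−Δ)) dz` is antitone on `[0, ∞)`. -/
theorem overlap_antitone_in_shift
    (f : ℝ → ℝ)
    (hf_nonneg : ∀ t, 0 ≤ f t) (hf_meas : Measurable f)
    (hf_even : ∀ t, f (-t) = f t)
    (hf_anti : AntitoneOn f (Set.Ici (0 : ℝ))) :
    ∀ Δ₁ Δ₂ : ℝ, 0 ≤ Δ₁ → Δ₁ ≤ Δ₂ →
      (∫⁻ z, ENNReal.ofReal (min (f z) (f (z - Δ₂)))) ≤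
        ∫⁻ z, ENNReal.ofReal (min (f z) (f (z - Δ₁))) := by
  intro Δ₁ Δ₂ h₁ h₁₂
  rw [lintegral_overlap_eq hf_even hf_anti h₁,
    lintegral_overlap_eq hf_even hf_anti (h₁.trans h₁₂)]
  refine lintegral_mono fun w => ENNReal.ofReal_le_ofReal (hf_anti ?_ ?_ ?_)
  · exact add_nonneg (abs_nonneg w) (by linarith)
  · exact add_nonneg (abs_nonneg w) (by linarith)
  · linarith
end

section
/- Let σ > 0 and μ₁, μ₂ ∈ ℝ, and let φ_{μ,σ}(z) = (1/(σ√(2π))) · exp(−(z − μ)²/(2σ²)) be the Gaussian density with mean μ and standard deviation σ. Then the overlap coefficient of the two equal-variance Gaussians is ∫ min(φ_{μ₁,σ}(z), φ_{μ₂,σ}(z)) dz = 2 · Φ(−|μ₁ − μ₂|/(2σ)), where Φ is the cumulative distribution function of the standard normal distribution. -/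
open MeasureTheory ENNReal Real

/-- Gaussian probability density with mean `μ` and standard deviation `σ`. -/
noncomputable def gaussDensity (μ σ z : ℝ) : ℝ :=
  (1 / (σ * Real.sqrt (2 * Real.pi))) * Real.exp (-(z - μ) ^ 2 / (2 * σ ^ 2))

/-- Standard normal cumulative distribution function. -/
noncomputable def stdNormalCDF (t : ℝ) : ℝ :=
  ∫ s in Set.Iic t, (1 / Real.sqrt (2 * Real.pi)) * Real.exp (-s ^ 2 / 2)

lemma gaussDensity_eq_gaussianPDFReal (μ : ℝ) {σ : ℝ} (hσ : 0 < σ) :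
    gaussDensity μ σ = ProbabilityTheory.gaussianPDFReal μ (σ ^ 2).toNNReal := by
  ext z
  rw [gaussDensity, ProbabilityTheory.gaussianPDFReal_def, Real.coe_toNNReal _ (sq_nonneg σ),
    Real.sqrt_mul (x := 2 * π) (by positivity) (σ ^ 2), Real.sqrt_sq hσ.le, one_div, mul_comm σ]

lemma gaussDensity_nonneg (μ z : ℝ) {σ : ℝ} (hσ : 0 < σ) : 0 ≤ gaussDensity μ σ z := by
  unfold gaussDensity
  positivity

lemma integrable_gaussDensity (μ : ℝ) {σ : ℝ} (hσ : 0 < σ) : Integrable (gaussDensity μ σ) := by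
  rw [gaussDensity_eq_gaussianPDFReal μ hσ]
  exact ProbabilityTheory.integrable_gaussianPDFReal _ _

lemma max_abs_sub_abs_sub (a b z : ℝ) :
    max |z - a| |z - b| = |z - (a + b) / 2| + |a - b| / 2 := by
  grind

lemma gaussDensity_antitone_abs {μ ν σ z w : ℝ} (hσ : 0 < σ) (h : |z - μ| ≤ |w - ν|) :
    gaussDensity ν σ w ≤ gaussDensity μ σ z := by
  have := sq_le_sq.2 h
  unfold gaussDensity
  gcongr

lemma min_gaussDensity (μ₁ μ₂ z : ℝ) {σ : ℝ} (hσ : 0 < σ) :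
    min (gaussDensity μ₁ σ z) (gaussDensity μ₂ σ z) =
      gaussDensity 0 σ (|z - (μ₁ + μ₂) / 2| + |μ₁ - μ₂| / 2) := by
  have key (μ : ℝ) : gaussDensity μ σ z = gaussDensity 0 σ |z - μ| := by simp [gaussDensity]
  rw [← max_abs_sub_abs_sub]
  rcases le_total |z - μ₁| |z - μ₂| with h | h
  · rw [max_eq_right h, min_eq_right (gaussDensity_antitone_abs hσ h), key]
  · rw [max_eq_left h, min_eq_left (gaussDensity_antitone_abs hσ h), key]

lemma setIntegral_Ioi_gaussDensity (a : ℝ) {σ : ℝ} (hσ : 0 < σ) :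
    ∫ z in Set.Ioi a, gaussDensity 0 σ z = stdNormalCDF (-a / σ) := by
  have h := integral_comp_mul_left_Ioi
    (fun s ↦ (1 / Real.sqrt (2 * Real.pi)) * Real.exp (-s ^ 2 / 2)) a (inv_pos.2 hσ)
  have hneg := integral_comp_neg_Ioi (σ⁻¹ * a)
    (fun s ↦ (1 / Real.sqrt (2 * Real.pi)) * Real.exp (-s ^ 2 / 2))
  simp only [neg_sq] at hneg
  rw [hneg, inv_inv, smul_eq_mul] at h
  rw [stdNormalCDF, show -a / σ = -(σ⁻¹ * a) by ring, ← mul_right_inj' hσ.ne', ← h,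
    ← integral_const_mul]
  refine integral_congr_ae (ae_of_all _ fun z ↦ ?_)
  dsimp only [gaussDensity]
  rw [show -(z - 0) ^ 2 / (2 * σ ^ 2) = -(σ⁻¹ * z) ^ 2 / 2 by field_simp; simp]
  field_simp

lemma setIntegral_Ioi_comp_add_right (f : ℝ → ℝ) (a d : ℝ) :
    ∫ z in Set.Ioi a, f (z + d) = ∫ z in Set.Ioi (a + d), f z := by
  rw [← (measurePreserving_add_right volume d).setIntegral_preimage_emb
    (measurableEmbedding_addRight d) f]
  simp

/-- **Overlap coefficient of two equal-variance Gaussians.**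
`∫ min(φ_{μ₁,σ}(z), φ_{μ₂,σ}(z)) dz = 2 · Φ(−|μ₁ − μ₂|/(2σ))`. -/
theorem gaussian_overlap_coefficient (σ μ₁ μ₂ : ℝ) (hσ : 0 < σ) :
    (∫⁻ z, ENNReal.ofReal (min (gaussDensity μ₁ σ z) (gaussDensity μ₂ σ z))) =
      ENNReal.ofReal (2 * stdNormalCDF (-|μ₁ - μ₂| / (2 * σ))) := by
  rw [← ofReal_integral_eq_lintegral_ofReal
    (f := fun z ↦ min (gaussDensity μ₁ σ z) (gaussDensity μ₂ σ z))
    ((integrable_gaussDensity μ₁ hσ).inf (integrable_gaussDensity μ₂ hσ))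
    (ae_of_all _ fun z ↦ le_min (gaussDensity_nonneg _ _ hσ) (gaussDensity_nonneg _ _ hσ))]
  congr 1
  simp_rw [min_gaussDensity μ₁ μ₂ _ hσ]
  rw [integral_sub_right_eq_self (fun z ↦ gaussDensity 0 σ (|z| + |μ₁ - μ₂| / 2)),
    integral_comp_abs (f := fun z ↦ gaussDensity 0 σ (z + |μ₁ - μ₂| / 2)),
    setIntegral_Ioi_comp_add_right, setIntegral_Ioi_gaussDensity _ hσ]
  congr 2
  ring
end

section
/- Let N ≥ 1, let f : ℝ^d → ℝ be a nonnegative measurable probability density (the common noise density), let z_1, …, z_N ∈ ℝ^d (the latent means), let D : ℝ^d → ℝ^m be measurable, and let x_1, …, x_N ∈ ℝ^m. Define the noise-injected densities p_i(z) = f(z − z_i). Then (1/N) · Σ_{i=1}^N ∫ f(z − z_i) ‖D(z) − x_i‖² dz ≥ (1/(4N²)) · Σ_{i=1}^N Σ_{j=1}^N (∫ min(f(z − z_i), f(z − z_j)) dz) · ‖x_i − x_j‖². -/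
open MeasureTheory ENNReal

/-- The overlap of two nonnegative weights, times the squared distance of two targets, is at most
twice the sum of the weighted squared errors of any common estimator. -/
theorem lintegral_min_mul_norm_sub_sq_le {α E : Type*} [MeasurableSpace α] {μ : Measure α}
    [SeminormedAddCommGroup E] [MeasurableSpace E] [OpensMeasurableSpace E]
    {p q : α → ℝ} (hp : Measurable p) (hp_nonneg : ∀ z, 0 ≤ p z) (hq_nonneg : ∀ z, 0 ≤ q z)
    {D : α → E} (hD : Measurable D) (a b : E) :
    (∫⁻ z, ENNReal.ofReal (min (p z) (q z)) ∂μ) * ENNReal.ofReal (‖a - b‖ ^ 2) ≤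
      2 * ((∫⁻ z, ENNReal.ofReal (p z * ‖D z - a‖ ^ 2) ∂μ) +
        ∫⁻ z, ENNReal.ofReal (q z * ‖D z - b‖ ^ 2) ∂μ) := by
  have hDa : Measurable fun z => ‖D z - a‖ :=
    (continuous_id.sub continuous_const).norm.measurable.comp hD
  have herr : Measurable fun z => ENNReal.ofReal (p z * ‖D z - a‖ ^ 2) :=
    (hp.mul (hDa.pow_const 2)).ennreal_ofReal
  rw [← lintegral_mul_const' _ _ ENNReal.ofReal_ne_top,
    ← lintegral_add_left herr, ← lintegral_const_mul' _ _ ENNReal.ofNat_ne_top]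
  refine lintegral_mono fun z => ?_
  have hmin : 0 ≤ min (p z) (q z) := le_min (hp_nonneg z) (hq_nonneg z)
  rw [← ENNReal.ofReal_mul hmin, ← ENNReal.ofReal_add
    (mul_nonneg (hp_nonneg z) (sq_nonneg _)) (mul_nonneg (hq_nonneg z) (sq_nonneg _)),
    ← ENNReal.ofReal_ofNat, ← ENNReal.ofReal_mul zero_le_two]
  refine ENNReal.ofReal_le_ofReal ?_
  have htri : ‖a - b‖ ≤ ‖D z - a‖ + ‖D z - b‖ := by
    simpa only [norm_sub_rev a (D z)] using norm_sub_le_norm_sub_add_norm_sub a (D z) b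
  calc min (p z) (q z) * ‖a - b‖ ^ 2
      ≤ min (p z) (q z) * (2 * (‖D z - a‖ ^ 2 + ‖D z - b‖ ^ 2)) := by
        gcongr
        exact (pow_le_pow_left₀ (norm_nonneg _) htri 2).trans add_sq_le
    _ = 2 * (min (p z) (q z) * ‖D z - a‖ ^ 2 + min (p z) (q z) * ‖D z - b‖ ^ 2) := by ring
    _ ≤ 2 * (p z * ‖D z - a‖ ^ 2 + q z * ‖D z - b‖ ^ 2) := by
        gcongr
        · exact min_le_left _ _
        · exact min_le_right _ _

/-- **Reconstruction MSE lower bound for noise-injected latents.**  With a common noise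
density `f` and latent means `z i`, the noise-injected densities are `pᵢ(z) = f(z − zᵢ)`,
and the average reconstruction MSE is bounded below by
`(1/(4N²)) · Σᵢⱼ (∫ min(f(z−zᵢ), f(z−zⱼ)) dz) · ‖xᵢ − xⱼ‖²`. -/
theorem reconstruction_mse_lower_bound_noise_injection
    (d m N : ℕ) (hN : 1 ≤ N)
    (f : EuclideanSpace ℝ (Fin d) → ℝ)
    (hf_nonneg : ∀ z, 0 ≤ f z) (hf_meas : Measurable f)
    (hf_prob : ∫⁻ z, ENNReal.ofReal (f z) = 1)
    (zc : Fin N → EuclideanSpace ℝ (Fin d))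
    (D : EuclideanSpace ℝ (Fin d) → EuclideanSpace ℝ (Fin m))
    (hD : Measurable D)
    (x : Fin N → EuclideanSpace ℝ (Fin m)) :
    (1 / (4 * (N : ℝ≥0∞) ^ 2)) *
        ∑ i : Fin N, ∑ j : Fin N,
          (∫⁻ z, ENNReal.ofReal (min (f (z - zc i)) (f (z - zc j)))) *
            ENNReal.ofReal (‖x i - x j‖ ^ 2)
      ≤ (1 / (N : ℝ≥0∞)) *
          ∑ i : Fin N, ∫⁻ z, ENNReal.ofReal (f (z - zc i) * ‖D z - x i‖ ^ 2) := by
  set A : Fin N → ℝ≥0∞ := fun i => ∫⁻ z, ENNReal.ofReal (f (z - zc i) * ‖D z - x i‖ ^ 2)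
  have hN0 : (N : ℝ≥0∞) ≠ 0 := by exact_mod_cast (Nat.one_le_iff_ne_zero.mp hN)
  have hNtop : (N : ℝ≥0∞) ≠ ∞ := ENNReal.natCast_ne_top N
  have hpair : ∀ i j, (∫⁻ z, ENNReal.ofReal (min (f (z - zc i)) (f (z - zc j)))) *
      ENNReal.ofReal (‖x i - x j‖ ^ 2) ≤ 2 * (A i + A j) := fun i j =>
    lintegral_min_mul_norm_sub_sq_le (hf_meas.comp (measurable_id.sub_const (zc i)))
      (fun z => hf_nonneg (z - zc i)) (fun z => hf_nonneg (z - zc j)) hD (x i) (x j)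
  have hsum : ∑ i, ∑ j, 2 * (A i + A j) = 4 * (N : ℝ≥0∞) * ∑ i, A i := by
    simp only [← Finset.mul_sum, Finset.sum_add_distrib, Finset.sum_const, Finset.card_univ,
      Fintype.card_fin, nsmul_eq_mul]
    ring
  have hcoef : 1 / (4 * (N : ℝ≥0∞) ^ 2) * (4 * N) = 1 / N := by
    rw [one_div, one_div, show 4 * (N : ℝ≥0∞) ^ 2 = 4 * N * N by ring,
      ENNReal.mul_inv (.inr hNtop) (.inr hN0), mul_right_comm,
      ENNReal.inv_mul_cancel (mul_ne_zero four_ne_zero hN0)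
        (ENNReal.mul_ne_top ENNReal.ofNat_ne_top hNtop), one_mul]
  calc _ ≤ 1 / (4 * (N : ℝ≥0∞) ^ 2) * ∑ i, ∑ j, 2 * (A i + A j) :=
        mul_le_mul_right
          (Finset.sum_le_sum fun i _ => Finset.sum_le_sum fun j _ => hpair i j) _
    _ = 1 / (N : ℝ≥0∞) * ∑ i, A i := by rw [hsum, ← mul_assoc, hcoef]
end

section
/- Let f : ℝ → ℝ be a nonnegative even probability density that is strictly decreasing and strictly positive on [0, ∞). Then the map Δ ↦ ∫ min(f(z), f(z − Δ)) dz is strictly decreasing on [0, ∞): for all 0 ≤ Δ₁ < Δ₂, ∫ min(f(z), f(z − Δ₂)) dz < ∫ min(f(z), f(z − Δ₁)) dz. -/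
open MeasureTheory ENNReal

/-- The overlap of an even function, decreasing on `[0, ∞)`, with its translate by `Δ`,
recentred at the midpoint of the two centers. -/
theorem lintegral_min_shift_eq {f : ℝ → ℝ} (hf_even : ∀ t, f (-t) = f t)
    (hf_anti : AntitoneOn f (Set.Ici (0 : ℝ))) {Δ : ℝ} (hΔ : 0 ≤ Δ) :
    ∫⁻ z, ENNReal.ofReal (min (f z) (f (z - Δ))) =
      ∫⁻ z, ENNReal.ofReal (f (|z| + Δ / 2)) := by
  have f_abs (t : ℝ) : f |t| = f t := by
    rcases abs_choice t with h | h <;> simp only [h, hf_even]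
  have key (z : ℝ) : min (f (z + Δ / 2)) (f (z + Δ / 2 - Δ)) = f (|z| + Δ / 2) := by
    rw [← f_abs (z + Δ / 2), ← f_abs (z + Δ / 2 - Δ),
      ← hf_anti.map_max (Set.mem_Ici.2 (abs_nonneg _)) (Set.mem_Ici.2 (abs_nonneg _))]
    congr 1
    grind
  rw [← lintegral_add_right_eq_self
    (fun z => ENNReal.ofReal (min (f z) (f (z - Δ)))) (Δ / 2)]
  simp only [key]

/-- **Strict antitonicity of the overlap in the shift.**  If `f : ℝ → ℝ` is a nonnegative
even probability density that is strictly decreasing and strictly positive on `[0, ∞)`,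
then `Δ ↦ ∫ min(f(z), f(z−Δ)) dz` is strictly decreasing on `[0, ∞)`. -/
theorem overlap_strictAnti_in_shift
    (f : ℝ → ℝ)
    (hf_nonneg : ∀ t, 0 ≤ f t) (hf_meas : Measurable f)
    (hf_prob : ∫⁻ t, ENNReal.ofReal (f t) = 1)
    (hf_even : ∀ t, f (-t) = f t)
    (hf_anti : StrictAntiOn f (Set.Ici (0 : ℝ)))
    (hf_pos : ∀ t : ℝ, 0 ≤ t → 0 < f t) :
    ∀ Δ₁ Δ₂ : ℝ, 0 ≤ Δ₁ → Δ₁ < Δ₂ →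
      (∫⁻ z, ENNReal.ofReal (min (f z) (f (z - Δ₂)))) <
        ∫⁻ z, ENNReal.ofReal (min (f z) (f (z - Δ₁))) := by
  intro Δ₁ Δ₂ h₁ h₁₂
  have h₂ : 0 ≤ Δ₂ := h₁.trans h₁₂.le
  have hfin : ∫⁻ z, ENNReal.ofReal (min (f z) (f (z - Δ₂))) ≠ ∞ := by
    refine ne_top_of_le_ne_top one_ne_top (hf_prob ▸ lintegral_mono fun z => ?_)
    exact ENNReal.ofReal_le_ofReal (min_le_left _ _)
  rw [lintegral_min_shift_eq hf_even hf_anti.antitoneOn h₂] at hfin ⊢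
  rw [lintegral_min_shift_eq hf_even hf_anti.antitoneOn h₁]
  refine lintegral_strict_mono (NeZero.ne _) (by fun_prop) hfin (.of_forall fun z => ?_)
  have hz₁ : 0 ≤ |z| + Δ₁ / 2 := by positivity
  have hz₂ : 0 ≤ |z| + Δ₂ / 2 := by positivity
  exact (ENNReal.ofReal_lt_ofReal_iff (hf_pos _ hz₁)).2 (hf_anti hz₁ hz₂ (by linarith))
end
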